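/- arXiv:0707.1313 — 3 statements merged into one kernel-verified Lean document; each statement's English description precedes it below -/
import Mathlib

section
/- Let X be a Polish space and let A be an analytic subset of X^ℕ (with the product topology). Then exactly one of the following holds: (a) there is a Borel map c : X → ℕ such that for every sequence (x_i)_{i∈ℕ} ∈ A the values c(x_i) are not all equal; (b) there is a Baire-measurable map u : ω^ω → X such that for every sequence (γ_i)_{i∈ℕ} ∈ 𝔸_ω, the sequence (u(γ_i))_{i∈ℕ} belongs to A. -/
open Set

/-- Concatenation `s ⌢ γ` of a finite sequence with an infinite sequence. -/
def cat {α : Type*} (s : List α) (γ : ℕ → α) : ℕ → α :=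
  fun k => if h : k < s.length then s.get ⟨k, h⟩ else γ (k - s.length)

/-- The set `𝔸_ω ⊆ (ω^ω)^ω` associated with the dense sequence `s`. -/
def Aomega (s : ℕ → List ℕ) : Set (ℕ → ℕ → ℕ) :=
  {x | ∃ n γ, ∀ i, x i = cat (s n ++ [i]) γ}

/-- A set has the Baire property if it differs from an open set by a meager set. -/
def HasBaireProperty {α : Type*} [TopologicalSpace α] (S : Set α) : Prop :=
  ∃ U : Set α, IsOpen U ∧ IsMeagre (symmDiff S U)

/-- A map is Baire-measurable if preimages of open sets have the Baire property. -/
def BaireMeasurableFun {α β : Type*} [TopologicalSpace α] [TopologicalSpace β]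
    (f : α → β) : Prop :=
  ∀ U : Set β, IsOpen U → HasBaireProperty (f ⁻¹' U)

/-! ### Initial segments and concatenation -/

/-- The initial segment of length `n` of an infinite sequence. -/
def initSeg (x : ℕ → ℕ) (n : ℕ) : List ℕ := (List.range n).map x

@[simp] theorem length_initSeg (x : ℕ → ℕ) (n : ℕ) : (initSeg x n).length = n := by
  simp [initSeg]

@[simp] theorem getElem_initSeg (x : ℕ → ℕ) (n k : ℕ) (h : k < (initSeg x n).length) :
    (initSeg x n)[k] = x k := by
  simp [initSeg]

@[simp] theorem initSeg_zero (x : ℕ → ℕ) : initSeg x 0 = [] := rfl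

theorem initSeg_succ (x : ℕ → ℕ) (n : ℕ) : initSeg x (n + 1) = initSeg x n ++ [x n] := by
  simp [initSeg, List.range_succ]

theorem initSeg_eq_iff {x : ℕ → ℕ} {n : ℕ} {t : List ℕ} (ht : t.length = n) :
    initSeg x n = t ↔ ∀ k (h : k < t.length), x k = t[k] := by
  constructor
  · rintro rfl k h
    simp
  · intro h
    refine List.ext_getElem (by simp [ht]) fun k _ h2 => ?_
    simpa using h k h2

theorem initSeg_eq_initSeg_iff {x y : ℕ → ℕ} {n : ℕ} :
    initSeg x n = initSeg y n ↔ ∀ k < n, x k = y k := by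
  rw [initSeg_eq_iff (by simp)]
  simp

theorem initSeg_add (x : ℕ → ℕ) (n k : ℕ) :
    initSeg x (n + k) = initSeg x n ++ initSeg (fun l => x (l + n)) k := by
  refine List.ext_getElem (by simp) fun l h1 h2 => ?_
  rw [List.getElem_append]
  split_ifs with h
  · simp
  · simp only [length_initSeg, not_lt] at h
    simp [h]

theorem cat_of_lt {s : List ℕ} {x : ℕ → ℕ} {k : ℕ} (h : k < s.length) : cat s x k = s[k] := by
  simp [cat, h]

theorem cat_of_le {s : List ℕ} {x : ℕ → ℕ} {k : ℕ} (h : s.length ≤ k) :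
    cat s x k = x (k - s.length) := by
  simp [cat, h]

theorem initSeg_cat (s : List ℕ) (x : ℕ → ℕ) (k : ℕ) :
    initSeg (cat s x) (s.length + k) = s ++ initSeg x k := by
  refine List.ext_getElem (by simp) fun l h1 h2 => ?_
  rw [List.getElem_append, getElem_initSeg]
  split_ifs with h
  · exact cat_of_lt h
  · simp [cat_of_le (not_lt.mp h)]

theorem cat_shift {x : ℕ → ℕ} {n : ℕ} {t : List ℕ} (h : initSeg x n = t) :
    cat t (fun k => x (k + n)) = x := by
  subst h
  funext k
  by_cases hk : k < n
  · rw [cat_of_lt (by simpa using hk)]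
    simp
  · rw [cat_of_le (by simpa using hk)]
    simp [Nat.sub_add_cancel (not_lt.mp hk)]

theorem cat_shift_cat (t t' : List ℕ) (a : ℕ) (x : ℕ → ℕ) :
    cat t (fun k => cat t' x (k + a)) =
      cat (t ++ t'.drop a) (fun k => x (k + (a - t'.length))) := by
  funext k
  by_cases hk : k < t.length
  · rw [cat_of_lt hk, cat_of_lt (by simp; omega), List.getElem_append_left hk]
  · rw [cat_of_le (not_lt.mp hk)]
    by_cases hk' : k - t.length + a < t'.length
    · rw [cat_of_lt hk', cat_of_lt (by simp; omega), List.getElem_append_right (by omega)]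
      simp [add_comm]
    · rw [cat_of_le (by omega), cat_of_le (by simp; omega)]
      congr 1
      simp
      omega

theorem cat_shift_add_length (t t' : List ℕ) (a : ℕ) (x : ℕ → ℕ) :
    cat t (fun k => cat t' x (k + (a + t'.length))) = cat t (fun k => x (k + a)) := by
  congr 1
  funext k
  rw [cat_of_le (by omega)]
  congr 1
  omega

/-! ### The topology of the Baire space -/

theorem isOpen_iff_initSeg {S : Set (ℕ → ℕ)} :
    IsOpen S ↔ ∀ x ∈ S, ∃ n, ∀ y, (∀ k < n, y k = x k) → y ∈ S := by
  constructor
  · intro h x hx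
    obtain ⟨_, ⟨y, n, rfl⟩, hxy, hS⟩ :=
      (PiNat.isTopologicalBasis_cylinders fun _ => ℕ).exists_subset_of_mem_open hx h
    refine ⟨n, fun z hz => hS ?_⟩
    rw [PiNat.mem_cylinder_iff] at hxy ⊢
    exact fun k hk => (hz k hk).trans (hxy k hk)
  · intro h
    refine isOpen_iff_mem_nhds.2 fun x hx => ?_
    obtain ⟨n, hn⟩ := h x hx
    exact Filter.mem_of_superset
      ((PiNat.isOpen_cylinder (fun _ => ℕ) x n).mem_nhds (PiNat.self_mem_cylinder x n))
      fun y hy => hn y (PiNat.mem_cylinder_iff.1 hy)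

theorem isOpen_setOf_initSeg_mem (n : ℕ) (T : Set (List ℕ)) :
    IsOpen {x : ℕ → ℕ | initSeg x n ∈ T} := by
  refine isOpen_iff_initSeg.2 fun x hx => ⟨n, fun y hy => ?_⟩
  change initSeg y n ∈ T
  rw [initSeg_eq_initSeg_iff.2 hy]
  exact hx

theorem continuous_cat (t : List ℕ) : Continuous (cat t : (ℕ → ℕ) → ℕ → ℕ) := by
  refine continuous_pi fun k => ?_
  by_cases hk : k < t.length
  · simp only [cat_of_lt hk]
    exact continuous_const
  · simp only [cat_of_le (not_lt.mp hk)]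
    exact continuous_apply _

theorem isOpenMap_cat (t : List ℕ) : IsOpenMap (cat t : (ℕ → ℕ) → ℕ → ℕ) := by
  intro U hU
  have : cat t '' U = {x | initSeg x t.length ∈ ({t} : Set _)} ∩
      (fun x k => x (k + t.length)) ⁻¹' U := by
    ext x
    constructor
    · rintro ⟨y, hy, rfl⟩
      refine ⟨by simpa using initSeg_cat t y 0, ?_⟩
      have : (fun k => cat t y (k + t.length)) = y := by
        funext k
        simp [cat_of_le]
      simpa only [mem_preimage, this] using hy
    · rintro ⟨h1, h2⟩
      exact ⟨_, h2, cat_shift h1⟩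
  rw [this]
  exact (isOpen_setOf_initSeg_mem _ _).inter
    (hU.preimage (continuous_pi fun k => continuous_apply _))

theorem mem_residual_of_isOpen_of_approx {S : Set (ℕ → ℕ)} (hS : IsOpen S)
    (h : ∀ (x : ℕ → ℕ) n, ∃ y ∈ S, ∀ k < n, y k = x k) : S ∈ residual (ℕ → ℕ) := by
  refine residual_of_dense_open hS (dense_iff_inter_open.2 fun U hU ⟨x, hx⟩ => ?_)
  obtain ⟨n, hn⟩ := isOpen_iff_initSeg.1 hU x hx
  obtain ⟨y, hy, hyx⟩ := h x n
  exact ⟨y, hn y hyx, hy⟩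

/-! ### An invariant comeagre set of sequences -/

/-- The sequences all of whose tail-modifications extend, for each `i`, infinitely many of the
finite sequences `s n ⌢ i`. -/
def genericSet (s : ℕ → List ℕ) : Set (ℕ → ℕ) :=
  {x | ∀ t a i N, ∃ n ≥ N, initSeg (cat t fun k => x (k + a)) (n + 1) = s n ++ [i]}

theorem cat_mem_genericSet_iff {s : ℕ → List ℕ} (t : List ℕ) (x : ℕ → ℕ) :
    cat t x ∈ genericSet s ↔ x ∈ genericSet s := by
  constructor
  · intro h t' a
    simpa only [cat_shift_add_length] using h t' (a + t.length)
  · intro h t' a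
    simpa only [cat_shift_cat] using h (t' ++ t.drop a) (a - t.length)

theorem exists_initSeg_of_mem_genericSet {s : ℕ → List ℕ} {x : ℕ → ℕ} (hx : x ∈ genericSet s)
    (i N : ℕ) : ∃ n ≥ N, initSeg x (n + 1) = s n ++ [i] := by
  have h := cat_shift (initSeg_zero x)
  simpa only [h] using hx [] 0 i N

theorem exists_drop_of_mem_genericSet {s : ℕ → List ℕ} (hlen : ∀ n, (s n).length = n)
    {x : ℕ → ℕ} (hx : x ∈ genericSet s) (j N : ℕ) :
    ∃ n ≥ N, j ≤ n ∧ (s n).drop j = initSeg x (n - j) := by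
  obtain ⟨n, hn, h⟩ := exists_initSeg_of_mem_genericSet
    ((cat_mem_genericSet_iff (List.replicate j 0) x).2 hx) 0 (max N j)
  have hj : j ≤ n := (le_max_right _ _).trans hn
  refine ⟨n, (le_max_left _ _).trans hn, hj, ?_⟩
  rw [initSeg_succ] at h
  have h1 := (List.append_inj h (by simp [hlen])).1
  have h2 := initSeg_cat (List.replicate j 0) x (n - j)
  simp only [List.length_replicate, Nat.add_sub_cancel' hj] at h2
  rw [← h1, h2]
  simp

theorem genericSet_mem_residual {s : ℕ → List ℕ} (hlen : ∀ n, (s n).length = n)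
    (hdense : ∀ t : List ℕ, ∃ n, t <+: s n) : genericSet s ∈ residual (ℕ → ℕ) := by
  have : genericSet s = ⋂ t, ⋂ a, ⋂ i, ⋂ N,
      {x | ∃ n ≥ N, initSeg (cat t fun k => x (k + a)) (n + 1) = s n ++ [i]} := by
    ext x
    simp [genericSet]
  rw [this]
  refine countable_iInter_mem.2 fun t => countable_iInter_mem.2 fun a =>
    countable_iInter_mem.2 fun i => countable_iInter_mem.2 fun N =>
    mem_residual_of_isOpen_of_approx ?_ fun x K => ?_
  · have : {x : ℕ → ℕ | ∃ n ≥ N, initSeg (cat t fun k => x (k + a)) (n + 1) = s n ++ [i]} =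
        ⋃ n, ⋃ (_ : n ≥ N), (fun x => cat t fun k => x (k + a)) ⁻¹'
          {y | initSeg y (n + 1) ∈ ({s n ++ [i]} : Set _)} := by
      ext x
      simp
    rw [this]
    exact isOpen_iUnion fun n => isOpen_iUnion fun _ => (isOpen_setOf_initSeg_mem _ _).preimage
      ((continuous_cat t).comp (continuous_pi fun k => continuous_apply _))
  · obtain ⟨n, w, hw⟩ :=
      hdense (initSeg (cat t fun k => x (k + a)) (t.length + (K + N)))
    have hn : t.length + (K + N) ≤ n := by
      rw [← hlen n, ← hw]
      simp
    have hs : ∀ l (hl : l < t.length + (K + N)),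
        (s n)[l]'(by rw [hlen]; omega) = cat t (fun k => x (k + a)) l := by
      intro l hl
      have : (s n)[l]'(by rw [hlen]; omega) = (initSeg (cat t fun k => x (k + a))
          (t.length + (K + N)) ++ w)[l]'(by simp; omega) := by
        simp only [hw]
      rw [this, List.getElem_append_left (by simpa using hl)]
      simp
    refine ⟨fun j => if j < K + N + a then x j else (s n ++ [i]).getD (j - a + t.length) 0,
      ⟨n, by omega, ?_⟩, fun k hk => if_pos (by omega)⟩
    rw [initSeg_eq_iff (by simp [hlen])]
    intro l hl
    simp only [List.length_append, hlen, List.length_singleton] at hl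
    by_cases h1 : l < t.length
    · rw [cat_of_lt h1, List.getElem_append_left (by rw [hlen]; omega), hs l (by omega),
        cat_of_lt h1]
    · rw [cat_of_le (not_lt.mp h1)]
      dsimp only
      split_ifs with h2
      · rw [List.getElem_append_left (by rw [hlen]; omega), hs l (by omega),
          cat_of_le (not_lt.mp h1)]
      · rw [show l - t.length + a - a + t.length = l by omega, List.getD_eq_getElem]

/-! ### Mutual exclusivity -/

theorem exists_monochromatic_mem_Aomega {s : ℕ → List ℕ} (hdense : ∀ t : List ℕ, ∃ n, t <+: s n)
    {X : Type*} [TopologicalSpace X] [MeasurableSpace X] [BorelSpace X] {c : X → ℕ}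
    (hc : Measurable c) {u : (ℕ → ℕ) → X} (hu : BaireMeasurableFun u) :
    ∃ x ∈ Aomega s, ∀ i j, c (u (x i)) = c (u (x j)) := by
  have hB : ∀ k, BaireMeasurableSet (u ⁻¹' (c ⁻¹' {k})) := by
    intro k
    have hm : @Measurable _ _ (eventuallyMeasurableSpace (borel (ℕ → ℕ)) (residual _)) _ u := by
      refine @measurable_of_isOpen X (ℕ → ℕ) _ _ _
        (eventuallyMeasurableSpace (borel (ℕ → ℕ)) (residual _)) u fun U hU => ?_
      obtain ⟨O, hO, hm⟩ := hu U hU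
      refine (BaireMeasurableSet.congr hO.baireMeasurableSet ?_ : BaireMeasurableSet (u ⁻¹' U))
      filter_upwards [hm] with x hx
      simp only [mem_compl_iff, mem_symmDiff, not_or, not_and, not_not] at hx
      exact propext ⟨fun h => hx.2 h, fun h => hx.1 h⟩
    exact hm (hc (measurableSet_singleton k))
  choose O hO hOe using fun k => (hB k).residualEq_isOpen
  have hR : ∀ᶠ x in residual (ℕ → ℕ), ∀ k, c (u x) = k ↔ x ∈ O k := by
    refine eventually_countable_forall.2 fun k => ?_
    filter_upwards [hOe k] with x hx
    exact iff_of_eq hx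
  obtain ⟨x, hx⟩ := (dense_of_mem_residual hR).nonempty
  have hxO : x ∈ O (c (u x)) := (hx _).1 rfl
  obtain ⟨n, hn⟩ := isOpen_iff_initSeg.1 (hO _) x hxO
  obtain ⟨m, w, hw⟩ := hdense (initSeg x n)
  have hev : ∀ᶠ y in residual (ℕ → ℕ), ∀ i k, c (u (cat (s m ++ [i]) y)) = k ↔
      cat (s m ++ [i]) y ∈ O k :=
    eventually_countable_forall.2 fun i =>
      (tendsto_residual_of_isOpenMap (continuous_cat _) (isOpenMap_cat _)).eventually hR
  obtain ⟨y, hy⟩ := (dense_of_mem_residual hev).nonempty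
  have key : ∀ i, c (u (cat (s m ++ [i]) y)) = c (u x) := by
    refine fun i => (hy i _).2 (hn _ fun k hk => ?_)
    rw [cat_of_lt (by simp [← hw]; omega)]
    simp only [← hw]
    rw [List.getElem_append_left (by simp; omega), List.getElem_append_left (by simpa using hk)]
    simp
  exact ⟨fun i => cat (s m ++ [i]) y, ⟨m, y, fun _ => rfl⟩, fun i j => by
    simp only [key]⟩

/-! ### Separation for independent sets -/

section Separation

variable {X : Type*} [MeasurableSpace X]

/-- `K 0` and the sets `K (i + 1)` are separated if the images `ψ '' K (i + 1)` are contained in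
Borel sets whose product avoids `φ '' K 0`. -/
def ProdSeparated (φ : (ℕ → ℕ) → ℕ → X) (ψ : (ℕ → ℕ) → X) (K : ℕ → Set (ℕ → ℕ)) : Prop :=
  ∃ B : ℕ → Set X, (∀ i, MeasurableSet (B i)) ∧ (∀ i, ∀ b ∈ K (i + 1), ψ b ∈ B i) ∧
    ∀ a ∈ K 0, ∃ i, φ a i ∉ B i

theorem ProdSeparated.of_forall_update {φ : (ℕ → ℕ) → ℕ → X} {ψ : (ℕ → ℕ) → X}
    {K : ℕ → Set (ℕ → ℕ)} (i k : ℕ)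
    (h : ∀ n, ProdSeparated φ ψ (Function.update K i (K i ∩ {x | x k = n}))) :
    ProdSeparated φ ψ K := by
  choose B hB hK hA using h
  rcases i with _ | i
  · refine ⟨fun l => ⋂ n, B n l, fun l => MeasurableSet.iInter fun n => hB n l,
      fun l b hb => mem_iInter.2 fun n => hK n l b (by simpa using hb), fun a ha => ?_⟩
    obtain ⟨l, hl⟩ := hA (a k) a (by simpa using ha)
    exact ⟨l, fun h => hl (mem_iInter.1 h _)⟩
  · refine ⟨fun l => if l = i then ⋃ n, B n l else ⋂ n, B n l, fun l => ?_, fun l b hb => ?_,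
      fun a ha => ?_⟩
    · dsimp only
      split_ifs
      · exact MeasurableSet.iUnion fun n => hB n l
      · exact MeasurableSet.iInter fun n => hB n l
    · dsimp only
      split_ifs with hl
      · subst hl
        exact mem_iUnion.2 ⟨b k, hK (b k) l b (by simpa using hb)⟩
      · exact mem_iInter.2 fun n => hK n l b (by simpa [Function.update_apply, hl] using hb)
    · by_cases hi : ∃ n, φ a i ∈ B n i
      · obtain ⟨n, hn⟩ := hi
        obtain ⟨l, hl⟩ := hA n a (by simpa [Function.update_apply] using ha)
        refine ⟨l, ?_⟩
        have hli : l ≠ i := by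
          rintro rfl
          exact hl hn
        simp only [hli, if_false, mem_iInter, not_forall]
        exact ⟨n, hl⟩
      · exact ⟨i, by simpa using hi⟩

theorem prodSeparated_univ [TopologicalSpace X] [T2Space X] [OpensMeasurableSpace X]
    {φ : (ℕ → ℕ) → ℕ → X} (hφ : Continuous φ) {ψ : (ℕ → ℕ) → X} (hψ : Continuous ψ)
    (hdisj : ∀ a (b : ℕ → ℕ → ℕ), ∃ i, φ a i ≠ ψ (b i)) :
    ProdSeparated φ ψ fun _ => univ := by
  by_contra hns
  have step : ∀ (j : ℕ) (K : {K // ¬ ProdSeparated φ ψ K}),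
      ∃ (n : ℕ) (K' : {K // ¬ ProdSeparated φ ψ K}),
        K'.1 = Function.update K.1 j.unpair.1 (K.1 j.unpair.1 ∩ {x | x j.unpair.2 = n}) := by
    rintro j ⟨K, hK⟩
    by_contra! h
    exact hK (ProdSeparated.of_forall_update j.unpair.1 j.unpair.2 fun n => by
      by_contra hn
      exact h n ⟨_, hn⟩ rfl)
  choose v next hnext using step
  let K : ℕ → {K // ¬ ProdSeparated φ ψ K} := fun j =>
    Nat.rec ⟨fun _ => univ, hns⟩ (fun j K => next j K) j
  have hK : ∀ j, (K (j + 1)).1 = Function.update (K j).1 j.unpair.1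
      ((K j).1 j.unpair.1 ∩ {x | x j.unpair.2 = v j (K j)}) := fun j => hnext j (K j)
  have hmono : ∀ J j, j < J → ∀ x ∈ (K J).1 j.unpair.1, x j.unpair.2 = v j (K j) := by
    intro J
    induction J with
    | zero => intro j hj; omega
    | succ J ih =>
      intro j hj x hx
      rw [hK J, Function.update_apply] at hx
      split_ifs at hx with h
      · rcases Nat.lt_succ_iff_lt_or_eq.1 hj with h' | rfl
        · exact ih j h' x (h ▸ hx.1)
        · exact hx.2
      · exact ih j (lt_of_le_of_ne (by omega) (by rintro rfl; exact h rfl)) x hx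
  let z : ℕ → ℕ → ℕ := fun i k => v (Nat.pair i k) (K (Nat.pair i k))
  have hz : ∀ i N, ∃ J, ∀ J' ≥ J, ∀ x ∈ (K J').1 i, ∀ k < N, x k = z i k := by
    refine fun i N => ⟨Nat.pair i N, fun J' hJ' x hx k hk => ?_⟩
    simpa using hmono J' (Nat.pair i k) ((Nat.pair_lt_pair_right i hk).trans_le hJ') x
      (by simpa using hx)
  obtain ⟨l, hl⟩ := hdisj (z 0) fun i => z (i + 1)
  obtain ⟨U, W, hU, hW, hzU, hzW, hUW⟩ := t2_separation hl
  obtain ⟨N, hN⟩ := isOpen_iff_initSeg.1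
    (hU.preimage ((continuous_apply l).comp hφ)) (z 0) hzU
  obtain ⟨N', hN'⟩ := isOpen_iff_initSeg.1 (hW.preimage hψ) (z (l + 1)) hzW
  obtain ⟨J, hJ⟩ := hz 0 N
  obtain ⟨J', hJ'⟩ := hz (l + 1) N'
  refine (K (max J J')).2 ⟨Function.update (fun _ => univ) l W, fun i => ?_, fun i b hb => ?_,
    fun a ha => ⟨l, ?_⟩⟩
  · rw [Function.update_apply]
    split_ifs
    · exact hW.measurableSet
    · exact MeasurableSet.univ
  · rw [Function.update_apply]
    split_ifs with hi
    · subst hi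
      exact hN' b (hJ' _ (le_max_right _ _) b hb)
    · trivial
  · rw [Function.update_self]
    exact fun h => disjoint_left.1 hUW (hN a (hJ _ (le_max_left _ _) a ha)) h

/-- A set is independent if it contains no sequence from the range of `φ`. -/
def IndepSet (φ : (ℕ → ℕ) → ℕ → X) (B : Set X) : Prop :=
  MeasurableSet B ∧ ∀ a, ∃ i, φ a i ∉ B

theorem exists_indepSet_superset [TopologicalSpace X] [T2Space X] [OpensMeasurableSpace X]
    {φ : (ℕ → ℕ) → ℕ → X} (hφ : Continuous φ) {B : Set X} (hB : MeasureTheory.AnalyticSet B)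
    (h : ∀ a, ∃ i, φ a i ∉ B) : ∃ B', B ⊆ B' ∧ IndepSet φ B' := by
  rw [MeasureTheory.AnalyticSet] at hB
  rcases hB with rfl | ⟨ψ, hψ, rfl⟩
  · exact ⟨∅, Subset.rfl, MeasurableSet.empty, h⟩
  · obtain ⟨B, hB, hr, ha⟩ := prodSeparated_univ hφ hψ fun a b => by
      obtain ⟨i, hi⟩ := h a
      exact ⟨i, fun e => hi ⟨b i, e.symm⟩⟩
    refine ⟨⋂ i, B i, ?_, MeasurableSet.iInter hB, fun a => ?_⟩
    · rintro _ ⟨b, rfl⟩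
      exact mem_iInter.2 fun i => hr i b trivial
    · obtain ⟨i, hi⟩ := ha a trivial
      exact ⟨i, fun h => hi (mem_iInter.1 h i)⟩

end Separation

/-! ### Homomorphisms into hypergraphs without dead ends -/

section Homomorphism

variable {Y : Type*}

/-- `g` restricted to sequences of length `n` is a homomorphism from the `n`-th finite
approximation of `Aomega s` to the hypergraph `E`. -/
def LevelHom (s : ℕ → List ℕ) (E : Set (ℕ → Y)) (n : ℕ) (g : List ℕ → Y) : Prop :=
  ∀ m w, m + 1 + w.length = n → (fun i => g (s m ++ [i] ++ w)) ∈ E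

theorem LevelHom.exists_extension {s : ℕ → List ℕ} {E : Set (ℕ → Y)}
    (hlen : ∀ n, (s n).length = n) (hE : ∀ y i, ∃ e ∈ E, e i = y) {n : ℕ}
    (hn : ∀ y t, t.length = n → ∃ g, LevelHom s E n g ∧ g t = y)
    {g : List ℕ → Y} (hg : LevelHom s E n g) (i : ℕ) :
    ∃ g', LevelHom s E (n + 1) g' ∧ ∀ t, g' (t ++ [i]) = g t := by
  obtain ⟨e, he, hei⟩ := hE (g (s n)) i
  have : ∀ j, ∃ f, LevelHom s E n f ∧ f (s n) = e j ∧ (j = i → f = g) := by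
    intro j
    by_cases hj : j = i
    · exact ⟨g, hg, by rw [hj, hei], fun _ => rfl⟩
    · obtain ⟨f, hf, hfe⟩ := hn (e j) (s n) (hlen n)
      exact ⟨f, hf, hfe, fun h => absurd h hj⟩
  choose f hf hfe hfi using this
  refine ⟨fun l => f (l.getLastD 0) l.dropLast, fun m w hw => ?_, fun t => ?_⟩
  · rcases List.eq_nil_or_concat w with rfl | ⟨w, j, rfl⟩
    · obtain rfl : m = n := by simpa using hw
      simpa [hfe] using he
    · have := hf j m w (by simp at hw; omega)
      simpa [← List.append_assoc, List.getLastD_eq_getLast?] using this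
  · simp [hfi]

theorem LevelHom.exists_eq {s : ℕ → List ℕ} {E : Set (ℕ → Y)}
    (hlen : ∀ n, (s n).length = n) (hE : ∀ y i, ∃ e ∈ E, e i = y) (n : ℕ) :
    ∀ y t, t.length = n → ∃ g, LevelHom s E n g ∧ g t = y := by
  induction n with
  | zero => exact fun y t _ => ⟨fun _ => y, fun m w h => by omega, rfl⟩
  | succ n ih =>
    intro y t ht
    rcases List.eq_nil_or_concat t with rfl | ⟨t, j, rfl⟩
    · simp at ht
    · obtain ⟨g, hg, hgt⟩ := ih y t (by simpa using ht)
      obtain ⟨g', hg', h⟩ := hg.exists_extension hlen hE ih j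
      exact ⟨g', hg', by simp [h, hgt]⟩

theorem exists_levelHom_seq [Nonempty Y] {s : ℕ → List ℕ} {E : Set (ℕ → Y)}
    (hlen : ∀ n, (s n).length = n) (hE : ∀ y i, ∃ e ∈ E, e i = y) (r : ℕ → ℕ) :
    ∃ g : ℕ → List ℕ → Y, (∀ n, LevelHom s E n (g n)) ∧
      ∀ n t, g (n + 1) (t ++ [r n]) = g n t := by
  have step : ∀ (n : ℕ) (g : {g // LevelHom s E n g}), ∃ g' : {g // LevelHom s E (n + 1) g},
      ∀ t, g'.1 (t ++ [r n]) = g.1 t := by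
    rintro n ⟨g, hg⟩
    obtain ⟨g', hg', h⟩ := hg.exists_extension hlen hE (LevelHom.exists_eq hlen hE n) (r n)
    exact ⟨⟨g', hg'⟩, h⟩
  choose next hnext using step
  obtain ⟨y⟩ := ‹Nonempty Y›
  have h0 : LevelHom s E 0 fun _ => y := fun m w h => by omega
  let G : ∀ n, {g // LevelHom s E n g} := fun n =>
    Nat.rec ⟨fun _ => y, h0⟩ (fun n g => next n g) n
  exact ⟨fun n => (G n).1, fun n => (G n).2, fun n t => hnext n (G n) t⟩

/-- If every vertex is the `i`-th vertex of some edge, for every `i`, then `Aomega s` maps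
homomorphically to the hypergraph. -/
theorem exists_hom_Aomega [Nonempty Y] {s : ℕ → List ℕ} {E : Set (ℕ → Y)}
    (hlen : ∀ n, (s n).length = n) (hE : ∀ y i, ∃ e ∈ E, e i = y) :
    ∃ h : (ℕ → ℕ) → Y, ∀ x ∈ Aomega s, (fun i => h (x i)) ∈ E := by
  choose g hg hgs using exists_levelHom_seq (Y := Y) hlen hE
  let r : (ℕ → ℕ) → ℕ → ℕ := fun x =>
    Quotient.out (Quotient.mk (Filter.germSetoid Filter.atTop ℕ) x)
  have hr : ∀ x, ∃ n, ∀ k ≥ n, x k = r x k := by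
    intro x
    have : r x =ᶠ[Filter.atTop] x :=
      Quotient.mk_out (s := Filter.germSetoid Filter.atTop ℕ) x
    obtain ⟨n, hn⟩ := Filter.eventually_atTop.1 this
    exact ⟨n, fun k hk => (hn k hk).symm⟩
  choose N hN using hr
  let h : (ℕ → ℕ) → Y := fun x => g (r x) (N x) (initSeg x (N x))
  have hadd : ∀ x n, (∀ k ≥ n, x k = r x k) → ∀ k,
      g (r x) (n + k) (initSeg x (n + k)) = g (r x) n (initSeg x n) := by
    intro x n hn k
    induction k with
    | zero => rfl
    | succ k ih => rw [← add_assoc, initSeg_succ, hn (n + k) (by omega), hgs, ih]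
  have hh : ∀ x n, (∀ k ≥ n, x k = r x k) → h x = g (r x) n (initSeg x n) := by
    intro x n hn
    rw [← hadd x n hn (N x), add_comm, hadd x (N x) (hN x)]
  refine ⟨h, ?_⟩
  rintro x ⟨m, γ, hx⟩
  have hxl : ∀ i k, m + 1 ≤ k → x i k = x 0 k := by
    intro i k hk
    rw [hx, hx, cat_of_le (by simpa [hlen] using hk), cat_of_le (by simpa [hlen] using hk)]
    simp
  have hrx : ∀ i, r (x i) = r (x 0) := by
    intro i
    have : Quotient.mk (Filter.germSetoid Filter.atTop ℕ) (x i) =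
        Quotient.mk (Filter.germSetoid Filter.atTop ℕ) (x 0) :=
      Quotient.sound (Filter.eventually_atTop.2 ⟨m + 1, fun k hk => hxl i k hk⟩)
    simp only [r, this]
  have : (fun i => h (x i)) = fun i =>
      g (r (x 0)) (m + 1 + N (x 0)) (s m ++ [i] ++ initSeg γ (N (x 0))) := by
    funext i
    rw [hh (x i) (m + 1 + N (x 0)), hrx, hx i]
    · have := initSeg_cat (s m ++ [i]) γ (N (x 0))
      rw [List.length_append, hlen, List.length_singleton] at this
      rw [this]
    · intro k hk
      rw [hrx, hxl i k (by omega)]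
      exact hN (x 0) k (by omega)
  rw [this]
  exact hg _ _ _ _ (by simp)

end Homomorphism

/-! ### Positive sets of configurations -/

section Configurations

/-- A configuration codes vertices (at index `0`) and witnesses for the edges of `Aomega s` splitting
at level `m` (at index `m + 1`), both indexed by finite sequences. -/
abbrev Config : Type := ℕ → List ℕ → ℕ → ℕ

/-- The part of a configuration consisting of the sequences that end with `w`. -/
def Config.restrict (w : List ℕ) (c : Config) : Config := fun j t => c j (t ++ w)

theorem Config.measurable_apply (j : ℕ) (t : List ℕ) : Measurable fun c : Config => c j t :=
  (measurable_pi_apply t).comp (measurable_pi_apply j)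

theorem Config.measurable_restrict (w : List ℕ) : Measurable (Config.restrict w) :=
  measurable_pi_lambda _ fun j => measurable_pi_lambda _ fun t =>
    Config.measurable_apply j (t ++ w)

/-- The coordinates of a configuration that are decided at stage `n`. -/
def Config.decided (s : ℕ → List ℕ) (n : ℕ) (c : Config) (j : Fin (n + 1)) (k : Fin n) : ℕ :=
  c j ((s n).drop j) k

theorem Config.measurable_decided (s : ℕ → List ℕ) (n : ℕ) : Measurable (Config.decided s n) :=
  measurable_pi_lambda _ fun j => measurable_pi_lambda _ fun k =>
    (measurable_pi_apply (k : ℕ)).comp (Config.measurable_apply j ((s n).drop j))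

variable {X : Type*} [MeasurableSpace X]

/-- A Borel set of configurations is positive if countably many independent sets never suffice to
meet the vertices of all its members. -/
def PositiveSet (φ : (ℕ → ℕ) → ℕ → X) (p : (ℕ → ℕ) → X) (P : Set Config) : Prop :=
  MeasurableSet P ∧ ∀ S : Set (Set X), S.Countable → (∀ B ∈ S, IndepSet φ B) →
    ∃ c ∈ P, ∀ t, ∀ B ∈ S, p (c 0 t) ∉ B

/-- The configurations all of whose slices belong to `P` and whose slices are joined by an edge at
`s n`. -/
def amalgam (φ : (ℕ → ℕ) → ℕ → X) (p : (ℕ → ℕ) → X) (s : ℕ → List ℕ) (n : ℕ)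
    (P : Set Config) : Set Config :=
  {c | (∀ i, c.restrict [i] ∈ P) ∧ ∀ i, φ (c (n + 1) []) i = p (c 0 (s n ++ [i]))}

theorem PositiveSet.nonempty {φ : (ℕ → ℕ) → ℕ → X} {p : (ℕ → ℕ) → X} {P : Set Config}
    (hP : PositiveSet φ p P) : P.Nonempty := by
  obtain ⟨c, hc, -⟩ := hP.2 ∅ countable_empty (by simp)
  exact ⟨c, hc⟩

theorem PositiveSet.exists_inter_preimage {φ : (ℕ → ℕ) → ℕ → X} {p : (ℕ → ℕ) → X}
    {P : Set Config} (hP : PositiveSet φ p P) {Z : Type*} [Countable Z] [MeasurableSpace Z]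
    [MeasurableSingletonClass Z] {D : Config → Z} (hD : Measurable D) :
    ∃ z, PositiveSet φ p (P ∩ D ⁻¹' {z}) := by
  by_contra! h
  have : ∀ z, ∃ S : Set (Set X), S.Countable ∧ (∀ B ∈ S, IndepSet φ B) ∧
      ∀ c ∈ P ∩ D ⁻¹' {z}, ∃ t, ∃ B ∈ S, p (c 0 t) ∈ B := by
    intro z
    by_contra! hz
    exact h z ⟨hP.1.inter (hD (measurableSet_singleton z)), hz⟩
  choose S hS hI hc using this
  obtain ⟨c, hcP, hcS⟩ := hP.2 (⋃ z, S z) (countable_iUnion hS) fun B hB => by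
    obtain ⟨z, hz⟩ := mem_iUnion.1 hB
    exact hI z B hz
  obtain ⟨t, B, hB, ht⟩ := hc (D c) c ⟨hcP, rfl⟩
  exact hcS t B (mem_iUnion.2 ⟨_, hB⟩) ht

theorem positiveSet_univ {φ : (ℕ → ℕ) → ℕ → X} {p : (ℕ → ℕ) → X}
    (hsurj : Function.Surjective p)
    (h : ¬ ∃ c : X → ℕ, Measurable c ∧ ∀ x ∈ range φ, ¬ ∀ i j, c (x i) = c (x j)) :
    PositiveSet φ p univ := by
  refine ⟨MeasurableSet.univ, fun S hS hI => ?_⟩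
  by_contra! hc
  have hcov : ∀ x, ∃ B ∈ S, x ∈ B := by
    intro x
    obtain ⟨b, rfl⟩ := hsurj x
    obtain ⟨-, hB⟩ := hc (fun _ _ => b) trivial
    exact hB
  obtain ⟨B₀, hB₀, -⟩ := hcov (p 0)
  obtain ⟨f, rfl⟩ := hS.exists_eq_range ⟨B₀, hB₀⟩
  simp only [exists_range_iff, forall_mem_range] at hcov hI
  classical
  refine h ⟨fun x => Nat.find (hcov x), measurable_find hcov fun k => (hI k).1, ?_⟩
  rintro _ ⟨a, rfl⟩ heq
  obtain ⟨i, hi⟩ := (hI (Nat.find (hcov (φ a 0)))).2 a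
  have h0 : Nat.find (hcov (φ a 0)) = Nat.find (hcov (φ a i)) := heq 0 i
  rw [h0] at hi
  exact hi (Nat.find_spec (hcov (φ a i)))

variable [TopologicalSpace X] [PolishSpace X] [BorelSpace X]

theorem PositiveSet.amalgam {φ : (ℕ → ℕ) → ℕ → X} (hφ : Continuous φ) {p : (ℕ → ℕ) → X}
    (hp : Continuous p) (s : ℕ → List ℕ) (n : ℕ) {P : Set Config} (hP : PositiveSet φ p P) :
    PositiveSet φ p (amalgam φ p s n P) := by
  have hpm : ∀ t, Measurable fun c : Config => p (c 0 t) := fun t =>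
    hp.measurable.comp (Config.measurable_apply 0 t)
  refine ⟨?_, fun S hS hI => ?_⟩
  · refine MeasurableSet.inter (s₁ := {c : Config | ∀ i, c.restrict [i] ∈ P})
      (s₂ := {c : Config | ∀ i, φ (c (n + 1) []) i = p (c 0 (s n ++ [i]))}) ?_ ?_
    · rw [ofPred_forall]
      exact MeasurableSet.iInter fun i => Config.measurable_restrict [i] hP.1
    · rw [ofPred_forall]
      exact MeasurableSet.iInter fun i => measurableSet_eq_fun
        ((((continuous_apply i).comp hφ).measurable).comp (Config.measurable_apply (n + 1) []))
        (hpm _)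
  · have hP' : MeasurableSet (P ∩ {c | ∀ t, ∀ B ∈ S, p (c 0 t) ∉ B}) := by
      refine hP.1.inter ?_
      rw [ofPred_forall]
      refine MeasurableSet.iInter fun t => ?_
      have : {c : Config | ∀ B ∈ S, p (c 0 t) ∉ B} =
          ⋂ B ∈ S, ((fun c : Config => p (c 0 t)) ⁻¹' B)ᶜ := by
        ext c
        simp
      rw [this]
      exact MeasurableSet.biInter hS fun B hB => (hpm t (hI B hB).1).compl
    have han := hP'.analyticSet_image (hpm (s n))
    have : ∃ a, ∀ i, φ a i ∈ (fun c : Config => p (c 0 (s n))) ''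
        (P ∩ {c | ∀ t, ∀ B ∈ S, p (c 0 t) ∉ B}) := by
      by_contra! h
      obtain ⟨B', hBB', hB'⟩ := exists_indepSet_superset hφ han h
      obtain ⟨c, hcP, hc⟩ := hP.2 (insert B' S) (hS.insert B') fun B hB => by
        rcases hB with rfl | hB
        exacts [hB', hI B hB]
      exact hc (s n) B' (mem_insert _ _) (hBB' ⟨c, ⟨hcP, fun t B hB =>
        hc t B (mem_insert_of_mem _ hB)⟩, rfl⟩)
    obtain ⟨a, ha⟩ := this
    choose c hc hca using ha
    refine ⟨fun j t => if t = [] then (if j = 0 then c 0 0 [] else a)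
      else c (t.getLastD 0) j t.dropLast, ⟨fun i => ?_, fun i => ?_⟩, fun t => ?_⟩
    · convert (hc i).1 using 1
      funext j t
      simp [Config.restrict, List.getLastD_eq_getLast?]
    · simpa [List.getLastD_eq_getLast?] using (hca i).symm
    · by_cases ht : t = []
      · simpa [ht] using (hc 0).2 []
      · simpa [ht] using (hc (t.getLastD 0)).2 t.dropLast

theorem exists_fusion {φ : (ℕ → ℕ) → ℕ → X} (hφ : Continuous φ) {p : (ℕ → ℕ) → X}
    (hp : Continuous p) (s : ℕ → List ℕ) (h : PositiveSet φ p univ) :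
    ∃ (P : ℕ → Set Config) (c : ℕ → Config), (∀ n, c n ∈ P n) ∧
      (∀ n, P (n + 1) ⊆ amalgam φ p s n (P n)) ∧
      ∀ n, ∀ d ∈ P n, Config.decided s n d = Config.decided s n (c n) := by
  have step : ∀ (n : ℕ) (P : {P // PositiveSet φ p P}), ∃ P' : {P // PositiveSet φ p P},
      P'.1 ⊆ amalgam φ p s n P.1 ∧ ∃ z, ∀ d ∈ P'.1, Config.decided s (n + 1) d = z := by
    rintro n ⟨P, hP⟩
    obtain ⟨z, hz⟩ := (hP.amalgam hφ hp s n).exists_inter_preimage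
      (Config.measurable_decided s (n + 1))
    exact ⟨⟨_, hz⟩, inter_subset_left, z, fun d hd => hd.2⟩
  choose next hsub z hz using step
  let P : ℕ → {P // PositiveSet φ p P} := fun n =>
    Nat.rec ⟨univ, h⟩ (fun n P => next n P) n
  choose c hc using fun n => (P n).2.nonempty
  refine ⟨fun n => (P n).1, c, hc, fun n => hsub n (P n), fun n d hd => ?_⟩
  rcases n with _ | n
  · funext j k
    exact k.elim0
  · exact (hz n (P n) d hd).trans (hz n (P n) _ (hc (n + 1))).symm

end Configurations

/-! ### The limit of a fusion sequence -/

section Limit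

variable {X : Type*} {φ : (ℕ → ℕ) → ℕ → X} {p : (ℕ → ℕ) → X} {s : ℕ → List ℕ}
  {P : ℕ → Set Config} {c : ℕ → Config}

theorem restrict_mem_of_fusion (hP : ∀ n, P (n + 1) ⊆ amalgam φ p s n (P n)) (w : List ℕ) :
    ∀ n, ∀ d ∈ P (n + w.length), d.restrict w ∈ P n := by
  induction w with
  | nil =>
    intro n d hd
    have : d.restrict [] = d := by
      funext j t
      simp [Config.restrict]
    rwa [this]
  | cons i w ih =>
    intro n d hd
    have := (hP n (ih (n + 1) d (by rwa [List.length_cons, ← add_assoc, add_right_comm] at hd))).1 i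
    have heq : d.restrict (i :: w) = (d.restrict w).restrict [i] := by
      funext j t
      simp [Config.restrict]
    rwa [heq]

theorem eq_of_mem_fusion (hP : ∀ n, P (n + 1) ⊆ amalgam φ p s n (P n))
    (hdec : ∀ n, ∀ d ∈ P n, Config.decided s n d = Config.decided s n (c n))
    {n M j : ℕ} (hnM : n ≤ M) (hjn : j ≤ n) {d : Config} (hd : d ∈ P M) {x : ℕ → ℕ}
    (hx : (s n).drop j = initSeg x (n - j)) {k : ℕ} (hk : k < n) :
    d j (initSeg x (M - j)) k = c n j ((s n).drop j) k := by
  obtain ⟨q, rfl⟩ := Nat.exists_eq_add_of_le hnM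
  rw [show n + q - j = n - j + q by omega, initSeg_add, ← hx]
  exact congr_fun (congr_fun (hdec n _ (restrict_mem_of_fusion hP
    (initSeg (fun l => x (l + (n - j))) q) n d (by simpa using hd))) ⟨j, by omega⟩) ⟨k, hk⟩

theorem exists_limit_of_fusion (hlen : ∀ n, (s n).length = n) (hc : ∀ n, c n ∈ P n)
    (hP : ∀ n, P (n + 1) ⊆ amalgam φ p s n (P n))
    (hdec : ∀ n, ∀ d ∈ P n, Config.decided s n d = Config.decided s n (c n))
    {x : ℕ → ℕ} (hx : x ∈ genericSet s) (j : ℕ) :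
    ∃ z : ℕ → ℕ, ∀ n ≥ j, (s n).drop j = initSeg x (n - j) →
      ∀ k < n, z k = c n j ((s n).drop j) k := by
  choose N hN hjN hxN using fun k => exists_drop_of_mem_genericSet hlen hx j (k + 1)
  refine ⟨fun k => c (N k) j ((s (N k)).drop j) k, fun n hn hxn k hk => ?_⟩
  exact (eq_of_mem_fusion hP hdec (le_max_left (N k) n) (hjN k) (hc _) (hxN k) (hN k)).symm.trans
    (eq_of_mem_fusion hP hdec (le_max_right (N k) n) hn (hc _) hxn hk)

theorem exists_generic_hom [TopologicalSpace X] [PolishSpace X] [MeasurableSpace X] [BorelSpace X]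
    (hlen : ∀ n, (s n).length = n) (hφ : Continuous φ) (hp : Continuous p)
    (h : PositiveSet φ p univ) :
    ∃ u : (ℕ → ℕ) → X,
      (∀ x ∈ genericSet s, ∀ m, (fun i => u (cat (s m ++ [i]) x)) ∈ range φ) ∧
      ∀ U, IsOpen U → ∃ O : Set (ℕ → ℕ), IsOpen O ∧ ∀ x ∈ genericSet s, u x ∈ U ↔ x ∈ O := by
  obtain ⟨P, c, hc, hP, hdec⟩ := exists_fusion hφ hp s h
  have hlim : ∀ x j, x ∈ genericSet s → ∃ z : ℕ → ℕ, ∀ n ≥ j, (s n).drop j = initSeg x (n - j) →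
      ∀ k < n, z k = c n j ((s n).drop j) k :=
    fun x j hx => exists_limit_of_fusion hlen hc hP hdec hx j
  choose! z hz using hlim
  refine ⟨fun x => p (z x 0), fun x hx m => ⟨z x (m + 1), funext fun i => ?_⟩, fun U hU => ?_⟩
  · set y := cat (s m ++ [i]) x with hy
    have hyG : y ∈ genericSet s := (cat_mem_genericSet_iff _ _).2 hx
    by_contra hne
    obtain ⟨V, W, hV, hW, hzV, hzW, hVW⟩ := t2_separation hne
    obtain ⟨N, hN⟩ := isOpen_iff_initSeg.1
      (hV.preimage ((continuous_apply i).comp hφ)) (z x (m + 1)) hzV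
    obtain ⟨N', hN'⟩ := isOpen_iff_initSeg.1 (hW.preimage hp) (z y 0) hzW
    obtain ⟨n, hnN, hmn, hxn⟩ := exists_drop_of_mem_genericSet hlen hx (m + 1) N
    obtain ⟨n', hnN', -, hyn⟩ := exists_drop_of_mem_genericSet hlen hyG 0 N'
    obtain ⟨q, hq⟩ := Nat.exists_eq_add_of_le (hmn.trans (le_max_left n n'))
    have hd := hc (max n n')
    have h1 : φ (c (max n n') (m + 1) (initSeg x (max n n' - (m + 1)))) i ∈ V := by
      refine hN _ fun k hk => ?_
      rw [eq_of_mem_fusion hP hdec (le_max_left _ _) hmn hd hxn (hk.trans_le hnN),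
        hz x (m + 1) hx n hmn hxn k (hk.trans_le hnN)]
    have h2 : p (c (max n n') 0 (initSeg y (max n n' - 0))) ∈ W := by
      refine hN' _ fun k hk => ?_
      rw [eq_of_mem_fusion hP hdec (le_max_right _ _) (Nat.zero_le _) hd hyn (hk.trans_le hnN'),
        hz y 0 hyG n' (Nat.zero_le _) hyn k (hk.trans_le hnN')]
    have h3 := (hP m (restrict_mem_of_fusion hP (initSeg x q) (m + 1) (c (max n n'))
      (by rwa [length_initSeg, ← hq]))).2 i
    have h4 := initSeg_cat (s m ++ [i]) x q
    rw [List.length_append, hlen, List.length_singleton, ← hq, ← hy] at h4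
    simp only [Config.restrict, List.nil_append] at h3
    rw [← h4] at h3
    rw [show max n n' - (m + 1) = q by omega, h3] at h1
    exact disjoint_left.1 hVW h1 h2
  · refine ⟨⋃ n, ⋃ (_ : ∀ b, (∀ k < n, b k = c n 0 (s n) k) → p b ∈ U),
      {x | initSeg x n ∈ ({s n} : Set _)},
      isOpen_iUnion fun n => isOpen_iUnion fun _ => isOpen_setOf_initSeg_mem _ _, fun x hx => ?_⟩
    have hz0 : ∀ n, initSeg x n = s n → ∀ k < n, z x 0 k = c n 0 (s n) k := fun n hn =>
      hz x 0 hx n (Nat.zero_le _) hn.symm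
    simp only [mem_iUnion, mem_ofPred_eq, mem_singleton_iff, exists_prop]
    constructor
    · intro hu
      obtain ⟨N, hN⟩ := isOpen_iff_initSeg.1 (hU.preimage hp) _ hu
      obtain ⟨n, hn, -, hxn⟩ := exists_drop_of_mem_genericSet hlen hx 0 N
      refine ⟨n, fun b hb => hN b fun k hk => ?_, hxn.symm⟩
      rw [hb k (hk.trans_le hn), hz0 n hxn.symm k (hk.trans_le hn)]
    · rintro ⟨n, hn, hxn⟩
      exact hn _ (hz0 n hxn)

end Limit

theorem exists_baireMeasurable_hom {s : ℕ → List ℕ} (hlen : ∀ n, (s n).length = n)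
    (hdense : ∀ t : List ℕ, ∃ n, t <+: s n) {X : Type*} [TopologicalSpace X] [PolishSpace X]
    [MeasurableSpace X] [BorelSpace X] {A : Set (ℕ → X)} (hA : MeasureTheory.AnalyticSet A)
    (h : ¬ ∃ c : X → ℕ, Measurable c ∧ ∀ x ∈ A, ¬ ∀ i j, c (x i) = c (x j)) :
    ∃ u : (ℕ → ℕ) → X, BaireMeasurableFun u ∧ ∀ γ ∈ Aomega s, (fun i => u (γ i)) ∈ A := by
  rw [MeasureTheory.AnalyticSet] at hA
  rcases hA with rfl | ⟨φ, hφ, rfl⟩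
  · exact absurd ⟨fun _ => 0, measurable_const, by simp⟩ h
  have : Nonempty X := ⟨φ 0 0⟩
  obtain ⟨p, hp, hsurj⟩ := PolishSpace.exists_nat_nat_continuous_surjective X
  obtain ⟨u, hu, huO⟩ := exists_generic_hom hlen hφ hp (positiveSet_univ hsurj h)
  have hG := genericSet_mem_residual hlen hdense
  have : Nonempty (genericSet s) := (dense_of_mem_residual hG).nonempty.to_subtype
  obtain ⟨f, hf⟩ := exists_hom_Aomega (Y := genericSet s)
    (E := {e | (fun i => u (e i)) ∈ range φ}) hlen (by
      rintro ⟨y, hy⟩ i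
      obtain ⟨n, -, hn⟩ := exists_initSeg_of_mem_genericSet hy i 0
      have hcat := cat_shift hn
      have hy' : (fun k => y (k + (n + 1))) ∈ genericSet s := by
        rwa [← cat_mem_genericSet_iff (s n ++ [i]), hcat]
      exact ⟨fun j => ⟨_, (cat_mem_genericSet_iff (s n ++ [j]) _).2 hy'⟩, hu _ hy' n,
        Subtype.ext hcat⟩)
  classical
  refine ⟨fun x => if x ∈ genericSet s then u x else u (f x), fun U hU => ?_, ?_⟩
  · obtain ⟨O, hO, hOG⟩ := huO U hU
    refine ⟨O, hO, ?_⟩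
    rw [IsMeagre]
    filter_upwards [hG] with x hx
    simp [hx, hOG x hx]
  · rintro γ ⟨n, x, hγ⟩
    by_cases hx : x ∈ genericSet s
    · simpa [hγ, cat_mem_genericSet_iff, hx] using hu x hx n
    · have := hf γ ⟨n, x, hγ⟩
      simpa [hγ, cat_mem_genericSet_iff, hx] using this

theorem stmt1 (s : ℕ → List ℕ)
    (hlen : ∀ n, (s n).length = n)
    (hdense : ∀ t : List ℕ, ∃ n, t <+: s n)
    (X : Type*) [TopologicalSpace X] [PolishSpace X]
    [MeasurableSpace X] [BorelSpace X]
    (A : Set (ℕ → X)) (hA : MeasureTheory.AnalyticSet A) :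
    Xor'
      (∃ c : X → ℕ, Measurable c ∧ ∀ x ∈ A, ¬ ∀ i j, c (x i) = c (x j))
      (∃ u : (ℕ → ℕ) → X, BaireMeasurableFun u ∧
        ∀ γ ∈ Aomega s, (fun i => u (γ i)) ∈ A) := by
  by_cases h : ∃ c : X → ℕ, Measurable c ∧ ∀ x ∈ A, ¬ ∀ i j, c (x i) = c (x j)
  · refine Or.inl ⟨h, ?_⟩
    rintro ⟨u, hu, huA⟩
    obtain ⟨c, hc, hcA⟩ := h
    obtain ⟨x, hx, heq⟩ := exists_monochromatic_mem_Aomega hdense hc hu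
    exact hcA _ (huA x hx) heq
  · exact Or.inr ⟨exists_baireMeasurable_hom hlen hdense hA h, h⟩
end

section
/- There exists a dense G_δ subset G of ω^ω which is invariant under the equivalence relation E₀ (i.e., if α ∈ G and β E₀ α then β ∈ G) and such that for every α ∈ G and all l, m ∈ ℕ there is n ≥ m with s_n⌢l a prefix of α. In particular, G ⊆ 𝔾. -/
open Set

/-- The finite sequence `t` is an initial segment of the infinite sequence `f`. -/
def IsPrefixFun {α : Type*} (t : List α) (f : ℕ → α) : Prop :=
  ∀ k, (h : k < t.length) → f k = t.get ⟨k, h⟩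

/-- The set `𝔾 ⊆ ω^ω` associated with the dense sequence `s`. -/
def Gset (s : ℕ → List ℕ) : Set (ℕ → ℕ) :=
  {α | ∀ m, ∃ n ≥ m, IsPrefixFun (s n ++ [0]) α}

/-- The equivalence relation `E₀`: eventual equality of sequences. -/
def E0 (α β : ℕ → ℕ) : Prop := ∃ m, ∀ n ≥ m, α n = β n

/-- Overwrite the initial part of `α` by the finite sequence `t`. -/
def overwrite (t : List ℕ) (α : ℕ → ℕ) : ℕ → ℕ := fun k => t.getD k (α k)

lemma overwrite_apply_of_lt {t : List ℕ} {k : ℕ} (h : k < t.length) (α : ℕ → ℕ) :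
    overwrite t α k = t[k] := by
  simp [overwrite, h]

lemma overwrite_apply_of_le {t : List ℕ} {k : ℕ} (h : t.length ≤ k) (α : ℕ → ℕ) :
    overwrite t α k = α k := by
  simp [overwrite, h]

lemma continuous_overwrite (t : List ℕ) : Continuous (overwrite t) := by
  refine continuous_pi fun k => ?_
  rcases lt_or_ge k t.length with h | h
  · simpa only [overwrite_apply_of_lt h] using continuous_const
  · simpa only [overwrite_apply_of_le h] using continuous_apply k

lemma E0.trans {α β γ : ℕ → ℕ} (h₁ : E0 α β) (h₂ : E0 β γ) : E0 α γ := by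
  obtain ⟨m, hm⟩ := h₁
  obtain ⟨n, hn⟩ := h₂
  exact ⟨max m n, fun k hk => (hm k (le_of_max_le_left hk)).trans (hn k (le_of_max_le_right hk))⟩

lemma E0_iff_exists_overwrite {α β : ℕ → ℕ} : E0 β α ↔ ∃ t, overwrite t α = β := by
  constructor
  · rintro ⟨m, hm⟩
    refine ⟨List.ofFn fun i : Fin m => β i, funext fun k => ?_⟩
    rcases lt_or_ge k m with h | h
    · rw [overwrite_apply_of_lt (by simpa using h)]
      simp
    · rw [overwrite_apply_of_le (by simpa using h), hm k h]
  · rintro ⟨t, rfl⟩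
    exact ⟨t.length, fun k hk => overwrite_apply_of_le hk α⟩

lemma isOpen_setOf_isPrefixFun (t : List ℕ) : IsOpen {α : ℕ → ℕ | IsPrefixFun t α} := by
  have : {α : ℕ → ℕ | IsPrefixFun t α} =
      ⋂ i : Fin t.length, (fun α : ℕ → ℕ => α i) ⁻¹' {t.get i} := by
    ext α
    simp [IsPrefixFun, Fin.forall_iff]
  rw [this]
  exact isOpen_iInter_of_finite fun i => (isOpen_discrete _).preimage (continuous_apply _)

lemma isPrefixFun_overwrite (t : List ℕ) (α : ℕ → ℕ) : IsPrefixFun t (overwrite t α) :=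
  fun _ h => overwrite_apply_of_lt h α

/-- The sequences having `s n ⌢ l` as an initial segment for some `n ≥ m`. -/
def hitSet (s : ℕ → List ℕ) (l m : ℕ) : Set (ℕ → ℕ) :=
  {α | ∃ n ≥ m, IsPrefixFun (s n ++ [l]) α}

lemma isOpen_hitSet (s : ℕ → List ℕ) (l m : ℕ) : IsOpen (hitSet s l m) := by
  have : hitSet s l m = ⋃ n ≥ m, {α | IsPrefixFun (s n ++ [l]) α} := by
    ext α
    simp [hitSet]
  rw [this]
  exact isOpen_biUnion fun n _ => isOpen_setOf_isPrefixFun _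

lemma dense_overwrite_preimage_hitSet {s : ℕ → List ℕ} (hlen : ∀ n, (s n).length = n)
    (hdense : ∀ t : List ℕ, ∃ n, t <+: s n) (l m : ℕ) (t : List ℕ) :
    Dense (overwrite t ⁻¹' hitSet s l m) := by
  rw [(PiNat.isTopologicalBasis_cylinders fun _ : ℕ => ℕ).dense_iff]
  rintro _ ⟨α, N, rfl⟩ -
  obtain ⟨n, hn⟩ := hdense (List.ofFn fun i : Fin (max (max N m) t.length) => overwrite t α i)
  have hle := hn.length_le
  rw [List.length_ofFn, hlen] at hle
  have hval : ∀ k, ∀ hk : k < max (max N m) t.length,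
      (s n ++ [l])[k]'(by simp [hlen]; omega) = overwrite t α k := fun k hk => by
    rw [List.getElem_append_left (by rw [hlen]; omega), ← hn.getElem (by simpa using hk)]
    simp
  refine ⟨fun k => if k < t.length then α k else overwrite (s n ++ [l]) α k, ?_, n, by omega, ?_⟩
  · rw [PiNat.mem_cylinder_iff]
    intro k hk
    split_ifs with h
    · rfl
    · rw [overwrite_apply_of_lt (by simp [hlen]; omega), hval k (by omega),
        overwrite_apply_of_le (by omega)]
  · intro k hk
    rcases lt_or_ge k t.length with h | h
    · rw [List.get_eq_getElem, hval k (by omega), overwrite_apply_of_lt h, overwrite_apply_of_lt h]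
    · rw [overwrite_apply_of_le h, if_neg (by omega), isPrefixFun_overwrite _ _ k hk]

theorem stmt9 (s : ℕ → List ℕ)
    (hlen : ∀ n, (s n).length = n)
    (hdense : ∀ t : List ℕ, ∃ n, t <+: s n) :
    ∃ G : Set (ℕ → ℕ), Dense G ∧ IsGδ G ∧
      (∀ α ∈ G, ∀ β, E0 β α → β ∈ G) ∧
      (∀ α ∈ G, ∀ l m : ℕ, ∃ n ≥ m, IsPrefixFun (s n ++ [l]) α) ∧
      G ⊆ Gset s := by
  have hG : {α : ℕ → ℕ | ∀ β, E0 β α → ∀ l m, β ∈ hitSet s l m} =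
      ⋂ p : List ℕ × ℕ × ℕ, overwrite p.1 ⁻¹' hitSet s p.2.1 p.2.2 := by
    ext α
    simp [E0_iff_exists_overwrite]
  have hopen (p : List ℕ × ℕ × ℕ) : IsOpen (overwrite p.1 ⁻¹' hitSet s p.2.1 p.2.2) :=
    (isOpen_hitSet s _ _).preimage (continuous_overwrite _)
  have hhit : ∀ α ∈ {α : ℕ → ℕ | ∀ β, E0 β α → ∀ l m, β ∈ hitSet s l m},
      ∀ l m, α ∈ hitSet s l m := fun α hα => hα α ⟨0, fun _ _ => rfl⟩
  refine ⟨{α | ∀ β, E0 β α → ∀ l m, β ∈ hitSet s l m}, ?_, ?_,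
    fun α hα β hβ γ hγ => hα γ (hγ.trans hβ), hhit, fun α hα => hhit α hα 0⟩
  · rw [hG]
    exact dense_iInter_of_isOpen hopen fun p => dense_overwrite_preimage_hitSet hlen hdense _ _ _
  · rw [hG]
    exact IsGδ.iInter_of_isOpen hopen
end

section
/- For every compact subset K of the Baire space ω^ω, no sequence (γ_i)_{i∈ℕ} ∈ 𝔸_ω satisfies γ_i ∈ K for all i; that is, 𝔸_ω ∩ K^ω = ∅. -/
open Set

/-- The entry of `s ⌢ i ⌢ γ` at position `|s|` is `i`. -/
theorem cat_append_singleton_length {α : Type*} (s : List α) (i : α) (γ : ℕ → α) :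
    cat (s ++ [i]) γ s.length = i := by
  simp [cat]

theorem stmt13 (s : ℕ → List ℕ)
    (hlen : ∀ n, (s n).length = n)
    (hdense : ∀ t : List ℕ, ∃ n, t <+: s n)
    (K : Set (ℕ → ℕ)) (hK : IsCompact K) :
    ∀ γ ∈ Aomega s, ¬ ∀ i, γ i ∈ K := by
  rintro x ⟨n, γ, hx⟩ hxK
  obtain ⟨b, hb⟩ := (hK.image (continuous_apply (s n).length)).bddAbove
  have h : x (b + 1) (s n).length ≤ b := hb ⟨x (b + 1), hxK (b + 1), rfl⟩
  rw [hx, cat_append_singleton_length] at h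
  omega
end
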